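/- For every T > 0, M ≥ 1 and ε ∈ (0,1] there exists a constant C > 0, depending only on M, ε and T, such that every smooth solution (v,u,θ,q) of the radiation hydrodynamics system on [0,T] with (M,ε)-bounded initial data satisfies ‖v(t,·)‖_{L^∞} ≤ C(1 + 𝔜(t)^{1/(2β+3)}) for all t ∈ [0,T]. -/

import Mathlib

open MeasureTheory Real Set

noncomputable section

namespace RadHydro

/-- Integral over one period `[-1/2, 1/2]` of the torus `𝕋 ≅ ℝ/ℤ`. -/
def tInt (f : ℝ → ℝ) : ℝ := ∫ x in (-(1/2) : ℝ)..(1/2 : ℝ), f x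

/-- Squared `L²` norm over the torus. -/
def L2sq (f : ℝ → ℝ) : ℝ := tInt fun x => (f x) ^ 2

/-- `L^∞` norm over the torus. -/
def Linf (f : ℝ → ℝ) : ℝ := sSup ((fun x => |f x|) '' Icc (-(1/2) : ℝ) (1/2))

/-- Squared `H¹` norm over the torus. -/
def H1sq (f : ℝ → ℝ) : ℝ := L2sq f + L2sq (deriv f)

/-- Squared `H²` norm over the torus. -/
def H2sq (f : ℝ → ℝ) : ℝ := L2sq f + L2sq (deriv f) + L2sq (deriv (deriv f))

/-- Partial derivative in the time variable. -/
def pt (f : ℝ → ℝ → ℝ) (t x : ℝ) : ℝ := deriv (fun s => f s x) t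

/-- Partial derivative in the space variable. -/
def px (f : ℝ → ℝ → ℝ) (t x : ℝ) : ℝ := deriv (f t) x

/-- The heat conductivity `κ(v, θ) = κ₁ + κ₂ v θ^β`. -/
def kappa (κ₁ κ₂ β v θ : ℝ) : ℝ := κ₁ + κ₂ * v * θ ^ β

/-- A smooth solution of the radiation hydrodynamics system (in Lagrangian
coordinates) on `[0, T]`: four `C^∞` functions on `[0,T] × ℝ` (modelled as smooth
functions on all of `ℝ × ℝ`), `1`-periodic in the space variable, with `v > 0`,
`θ > 0`, satisfying the four equations pointwise for `t ∈ [0, T]`, and with the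
normalization `∫_𝕋 v(0, x) dx = 1`. -/
structure Sol (μ R a b κ₁ κ₂ β γ T : ℝ) where
  v : ℝ → ℝ → ℝ
  u : ℝ → ℝ → ℝ
  θ : ℝ → ℝ → ℝ
  q : ℝ → ℝ → ℝ
  smooth_v : ContDiff ℝ (⊤ : ℕ∞) fun p : ℝ × ℝ => v p.1 p.2
  smooth_u : ContDiff ℝ (⊤ : ℕ∞) fun p : ℝ × ℝ => u p.1 p.2
  smooth_θ : ContDiff ℝ (⊤ : ℕ∞) fun p : ℝ × ℝ => θ p.1 p.2
  smooth_q : ContDiff ℝ (⊤ : ℕ∞) fun p : ℝ × ℝ => q p.1 p.2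
  periodic_v : ∀ t, Function.Periodic (v t) 1
  periodic_u : ∀ t, Function.Periodic (u t) 1
  periodic_θ : ∀ t, Function.Periodic (θ t) 1
  periodic_q : ∀ t, Function.Periodic (q t) 1
  v_pos : ∀ t x, 0 < v t x
  θ_pos : ∀ t x, 0 < θ t x
  eq_mass : ∀ t ∈ Icc (0 : ℝ) T, ∀ x : ℝ, pt v t x - px u t x = 0
  eq_mom : ∀ t ∈ Icc (0 : ℝ) T, ∀ x : ℝ,
    pt u t x + px (fun s y => R * θ s y / v s y) t x
      = px (fun s y => μ * px u s y / v s y) t x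
  eq_energy : ∀ t ∈ Icc (0 : ℝ) T, ∀ x : ℝ,
    pt (fun s y => R / (γ - 1) * θ s y + (u s y) ^ 2 / 2) t x
      + px (fun s y => R * θ s y / v s y * u s y) t x + px q t x
      = px (fun s y => μ * u s y * px u s y / v s y) t x
        + px (fun s y => kappa κ₁ κ₂ β (v s y) (θ s y) * px θ s y / v s y) t x
  eq_rad : ∀ t ∈ Icc (0 : ℝ) T, ∀ x : ℝ,
    -px (fun s y => px q s y / v s y) t x + a * v t x * q t x
      + b * px (fun s y => (θ s y) ^ 4) t x = 0
  mean_v : tInt (v 0) = 1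

/-- `(M, ε)`-bounded initial data: `‖(v₀, u₀, θ₀)‖_{H²} ≤ M` and `v₀ ≥ ε`, `θ₀ ≥ ε`. -/
def DataBounded (M ε : ℝ) (v₀ u₀ θ₀ : ℝ → ℝ) : Prop :=
  Real.sqrt (H2sq v₀ + H2sq u₀ + H2sq θ₀) ≤ M ∧ (∀ x, ε ≤ v₀ x) ∧ ∀ x, ε ≤ θ₀ x

variable {μ R a b κ₁ κ₂ β γ T : ℝ}

/-- A solution has `(M, ε)`-bounded initial data. -/
def Sol.Bounded (S : Sol μ R a b κ₁ κ₂ β γ T) (M ε : ℝ) : Prop :=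
  DataBounded M ε (S.v 0) (S.u 0) (S.θ 0)

/-- The auxiliary function `𝔛(t) = ∫₀ᵗ ∫_𝕋 κ(v,θ) θ_t² / v dx ds`. -/
def Sol.X (S : Sol μ R a b κ₁ κ₂ β γ T) (t : ℝ) : ℝ :=
  ∫ s in (0 : ℝ)..t, tInt fun x =>
    kappa κ₁ κ₂ β (S.v s x) (S.θ s x) * (pt S.θ s x) ^ 2 / S.v s x

/-- The auxiliary function `𝔜(t) = max_{0 ≤ s ≤ t} ∫_𝕋 κ(v,θ)² θ_x² / v² dx`. -/
def Sol.Y (S : Sol μ R a b κ₁ κ₂ β γ T) (t : ℝ) : ℝ :=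
  sSup ((fun s => tInt fun x =>
    (kappa κ₁ κ₂ β (S.v s x) (S.θ s x)) ^ 2 * (px S.θ s x) ^ 2 / (S.v s x) ^ 2) ''
      Icc (0 : ℝ) t)

/-- The auxiliary function `ℨ(t) = max_{0 ≤ s ≤ t} ∫_𝕋 u_{xx}² / v² dx`. -/
def Sol.Z (S : Sol μ R a b κ₁ κ₂ β γ T) (t : ℝ) : ℝ :=
  sSup ((fun s => tInt fun x => (px (px S.u) s x) ^ 2 / (S.v s x) ^ 2) '' Icc (0 : ℝ) t)

/-- The exponent `𝔗₀(n, p, β)`. -/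
def T0 (n _p β : ℝ) : ℝ :=
  if n < (β + 3) / 2 then 4 / (n * (2 * β + 3)) else (n - β + 5) / (n * (2 * β + 3))

/-- The exponent `𝔗₁(n, β)`. -/
def T1 (n β : ℝ) : ℝ := max (T0 n 8 β) (1 / (2 * β + 3) + T0 n 1 β)

/-- The exponent `𝔘ʸ₁₁(n, β)`. -/
def Uy11 (n β : ℝ) : ℝ := 2 / (2 * β + 3) + T0 n 1 β

/-- The exponent `𝔘ᶻ₁₁(n, β)`. -/
def Uz11 (n β : ℝ) : ℝ := 3 / 4 * (1 / (1 - T0 n (5/2) β))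

/-- The exponent `𝔘ʸ₂(n, β)`. -/
def Uy2 (n β : ℝ) : ℝ := 2 / (2 * β + 3) + T1 n β

/-- The exponent `𝔘ᶻ₂(n, β)`. -/
def Uz2 (n β : ℝ) : ℝ := 3 / 4 * (1 / (1 - T0 n (3/2) β - T1 n β))

end RadHydro

open RadHydro

namespace RadHydro

section Calculus

variable {f g : ℝ → ℝ → ℝ}

lemma contDiff_slice_right (hf : ContDiff ℝ (⊤ : ℕ∞) fun p : ℝ × ℝ => f p.1 p.2) (t : ℝ) :
    ContDiff ℝ (⊤ : ℕ∞) (f t) :=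
  hf.comp (contDiff_const.prodMk contDiff_id)

lemma contDiff_slice_left (hf : ContDiff ℝ (⊤ : ℕ∞) fun p : ℝ × ℝ => f p.1 p.2) (x : ℝ) :
    ContDiff ℝ (⊤ : ℕ∞) fun t => f t x :=
  hf.comp (contDiff_id.prodMk contDiff_const)

lemma differentiable_slice (hf : ContDiff ℝ (⊤ : ℕ∞) fun p : ℝ × ℝ => f p.1 p.2) (t : ℝ) :
    Differentiable ℝ (f t) :=
  (contDiff_slice_right hf t).differentiable (by simp)

lemma hasDerivAt_px (hf : ContDiff ℝ (⊤ : ℕ∞) fun p : ℝ × ℝ => f p.1 p.2) (t x : ℝ) :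
    HasDerivAt (f t) (px f t x) x :=
  (differentiable_slice hf t x).hasDerivAt

lemma hasDerivAt_pt (hf : ContDiff ℝ (⊤ : ℕ∞) fun p : ℝ × ℝ => f p.1 p.2) (t x : ℝ) :
    HasDerivAt (fun s => f s x) (pt f t x) t :=
  ((contDiff_slice_left hf x).differentiable (by simp) t).hasDerivAt

lemma contDiff_px (hf : ContDiff ℝ (⊤ : ℕ∞) fun p : ℝ × ℝ => f p.1 p.2) :
    ContDiff ℝ (⊤ : ℕ∞) fun p : ℝ × ℝ => px f p.1 p.2 := by
  have h : (fun p : ℝ × ℝ => px f p.1 p.2)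
      = fun p => fderiv ℝ (fun p : ℝ × ℝ => f p.1 p.2) p (0, 1) := by
    funext p
    have h1 : HasFDerivAt (fun p : ℝ × ℝ => f p.1 p.2)
        (fderiv ℝ (fun p : ℝ × ℝ => f p.1 p.2) p) (p.1, p.2) :=
      (hf.differentiable (by simp) p).hasFDerivAt
    have h2 : HasDerivAt (fun x : ℝ => (p.1, x)) ((0 : ℝ), (1 : ℝ)) p.2 :=
      (hasDerivAt_const _ _).prodMk (hasDerivAt_id _)
    exact (h1.comp_hasDerivAt p.2 h2).deriv
  rw [h]
  exact (hf.fderiv_right (by simp)).clm_apply contDiff_const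

lemma contDiff_pt (hf : ContDiff ℝ (⊤ : ℕ∞) fun p : ℝ × ℝ => f p.1 p.2) :
    ContDiff ℝ (⊤ : ℕ∞) fun p : ℝ × ℝ => pt f p.1 p.2 := by
  have h := contDiff_px (f := fun t x => f x t)
    (hf.comp (contDiff_snd.prodMk contDiff_fst))
  exact h.comp (contDiff_snd.prodMk contDiff_fst)

lemma integral_swap_of_continuous (hf : Continuous fun p : ℝ × ℝ => f p.1 p.2) (a b c d : ℝ) :
    ∫ s in a..b, ∫ x in c..d, f s x = ∫ x in c..d, ∫ s in a..b, f s x := by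
  apply intervalIntegral_intervalIntegral_swap
  have h : IntegrableOn (fun p : ℝ × ℝ => f p.1 p.2) (uIcc a b ×ˢ uIcc c d) :=
    hf.continuousOn.integrableOn_compact (isCompact_uIcc.prod isCompact_uIcc)
  exact h.mono_set (prod_mono uIoc_subset_uIcc uIoc_subset_uIcc)

/-- The integral form of a local conservation law `f_t = g_x`. -/
lemma integral_sub_eq_of_pt_eq_px (hf : ContDiff ℝ (⊤ : ℕ∞) fun p : ℝ × ℝ => f p.1 p.2)
    (hg : ContDiff ℝ (⊤ : ℕ∞) fun p : ℝ × ℝ => g p.1 p.2) {T : ℝ}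
    (h : ∀ t ∈ Icc (0 : ℝ) T, ∀ x, pt f t x = px g t x) {t : ℝ} (ht : t ∈ Icc (0 : ℝ) T)
    (c d : ℝ) :
    ∫ x in c..d, (f t x - f 0 x) = ∫ s in (0 : ℝ)..t, (g s d - g s c) := by
  have hpt := (contDiff_pt hf).continuous
  have e1 : ∀ x, f t x - f 0 x = ∫ s in (0 : ℝ)..t, pt f s x := fun x =>
    (intervalIntegral.integral_eq_sub_of_hasDerivAt (fun s _ => hasDerivAt_pt hf s x)
      ((hpt.comp (Continuous.prodMk continuous_id continuous_const)).intervalIntegrable _ _)).symm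
  simp_rw [e1]
  rw [← integral_swap_of_continuous hpt]
  apply intervalIntegral.integral_congr
  intro s hs
  rw [uIcc_of_le ht.1] at hs
  have hs' : s ∈ Icc (0 : ℝ) T := ⟨hs.1, hs.2.trans ht.2⟩
  simp only [h s hs']
  exact intervalIntegral.integral_eq_sub_of_hasDerivAt (fun x _ => hasDerivAt_px hg s x)
    (((contDiff_px hg).continuous.comp
      (Continuous.prodMk continuous_const continuous_id)).intervalIntegrable _ _)

lemma px_periodic (hf : ∀ t, Function.Periodic (f t) 1) (t : ℝ) :
    Function.Periodic (px f t) 1 := by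
  intro x
  have h : (fun y => f t (y + 1)) = f t := funext (hf t)
  have h2 := deriv_comp_add_const (f t) 1 x
  rw [h] at h2
  exact h2.symm

lemma eq_endpoints_of_periodic {h : ℝ → ℝ} (hh : Function.Periodic h 1) :
    h (1 / 2) = h (-(1 / 2)) := by
  have := hh (-(1 / 2))
  norm_num at this ⊢
  exact this

lemma tInt_mono {h k : ℝ → ℝ} (hh : Continuous h) (hk : Continuous k)
    (hle : ∀ x ∈ Icc (-(1 / 2) : ℝ) (1 / 2), h x ≤ k x) : tInt h ≤ tInt k :=
  intervalIntegral.integral_mono_on (by norm_num) (hh.intervalIntegrable _ _)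
    (hk.intervalIntegrable _ _) hle

lemma tInt_nonneg {h : ℝ → ℝ} (hh : ∀ x, 0 ≤ h x) : 0 ≤ tInt h :=
  intervalIntegral.integral_nonneg_of_forall (by norm_num) hh

lemma tInt_const (c : ℝ) : tInt (fun _ => c) = c := by
  simp only [tInt, intervalIntegral.integral_const, smul_eq_mul]; ring

lemma abs_integral_le_tInt {h k : ℝ → ℝ} (hh : Continuous h) (hk : Continuous k)
    (hle : ∀ x, |h x| ≤ k x) {c d : ℝ} (hc : c ∈ Icc (-(1 / 2) : ℝ) (1 / 2))
    (hd : d ∈ Icc (-(1 / 2) : ℝ) (1 / 2)) : |∫ x in c..d, h x| ≤ tInt k := by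
  wlog hcd : c ≤ d generalizing c d
  · rw [intervalIntegral.integral_symm, abs_neg]
    exact this hd hc (le_of_not_ge hcd)
  calc |∫ x in c..d, h x| ≤ ∫ x in c..d, |h x| := intervalIntegral.abs_integral_le_integral_abs hcd
    _ ≤ ∫ x in c..d, k x := intervalIntegral.integral_mono_on hcd
        (hh.abs.intervalIntegrable _ _) (hk.intervalIntegrable _ _) fun x _ => hle x
    _ ≤ tInt k := intervalIntegral.integral_mono_interval hc.1 hcd hd.2
        (Filter.Eventually.of_forall fun x => (abs_nonneg _).trans (hle x))
        (hk.intervalIntegrable _ _)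

lemma exists_le_tInt {h : ℝ → ℝ} (hh : Continuous h) :
    ∃ y ∈ Icc (-(1 / 2) : ℝ) (1 / 2), h y ≤ tInt h := by
  obtain ⟨y, hy, hmin⟩ := isCompact_Icc.exists_isMinOn
    (nonempty_Icc.2 (by norm_num : (-(1 / 2) : ℝ) ≤ 1 / 2)) hh.continuousOn
  refine ⟨y, hy, ?_⟩
  rw [← tInt_const (h y)]
  exact tInt_mono continuous_const hh fun x hx => hmin hx

lemma continuous_tInt (hf : Continuous fun p : ℝ × ℝ => f p.1 p.2) :
    Continuous fun t => tInt (f t) :=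
  intervalIntegral.continuous_parametric_intervalIntegral_of_continuous' hf _ _

/-- Grönwall's inequality in integral form. -/
lemma le_of_le_add_integral {F : ℝ → ℝ} (hF : Continuous F) (hpos : ∀ t, 0 ≤ F t) {A B T : ℝ}
    (hA : 0 ≤ A) (hB : 0 ≤ B)
    (h : ∀ t ∈ Icc (0 : ℝ) T, F t ≤ A + B * ∫ s in (0 : ℝ)..t, F s) {t : ℝ}
    (ht : t ∈ Icc (0 : ℝ) T) : F t ≤ A + B * gronwallBound 0 B A T := by
  have hder : ∀ x, HasDerivAt (fun t => ∫ s in (0 : ℝ)..t, F s) (F x) x := fun x =>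
    intervalIntegral.integral_hasDerivAt_right (hF.intervalIntegrable _ _)
      hF.stronglyMeasurable.stronglyMeasurableAtFilter hF.continuousAt
  have hG : ∀ x ∈ Icc (0 : ℝ) T,
      ‖∫ s in (0 : ℝ)..x, F s‖ ≤ gronwallBound 0 B A (x - 0) := by
    apply norm_le_gronwallBound_of_norm_deriv_right_le (f' := F)
      (fun x _ => (hder x).continuousAt.continuousWithinAt)
      (fun x _ => (hder x).hasDerivWithinAt) (by simp)
    intro x hx
    have hx0 : 0 ≤ ∫ s in (0 : ℝ)..x, F s :=
      intervalIntegral.integral_nonneg_of_forall hx.1 hpos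
    rw [Real.norm_of_nonneg (hpos x), Real.norm_of_nonneg hx0]
    linarith [h x ⟨hx.1, hx.2.le⟩]
  have h1 := (le_abs_self _).trans (hG t ht)
  have h2 : gronwallBound 0 B A (t - 0) ≤ gronwallBound 0 B A T :=
    gronwallBound_mono le_rfl hA hB (by linarith [ht.2])
  have := mul_le_mul_of_nonneg_left (h1.trans h2) hB
  linarith [h t ht]

end Calculus

namespace Sol

variable {μ R a b κ₁ κ₂ β γ T : ℝ} (S : Sol μ R a b κ₁ κ₂ β γ T)

lemma continuous_v : Continuous fun p : ℝ × ℝ => S.v p.1 p.2 := S.smooth_v.continuous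

lemma continuous_θ : Continuous fun p : ℝ × ℝ => S.θ p.1 p.2 := S.smooth_θ.continuous

lemma continuous_v_slice (t : ℝ) : Continuous (S.v t) := (contDiff_slice_right S.smooth_v t).continuous

lemma continuous_u_slice (t : ℝ) : Continuous (S.u t) := (contDiff_slice_right S.smooth_u t).continuous

lemma continuous_θ_slice (t : ℝ) : Continuous (S.θ t) := (contDiff_slice_right S.smooth_θ t).continuous

/-- The specific volume has mean one at all times. -/
lemma tInt_v {t : ℝ} (ht : t ∈ Icc (0 : ℝ) T) : tInt (S.v t) = 1 := by
  have h := integral_sub_eq_of_pt_eq_px S.smooth_v S.smooth_u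
    (fun t ht x => sub_eq_zero.1 (S.eq_mass t ht x)) ht (-(1 / 2)) (1 / 2)
  rw [intervalIntegral.integral_sub ((S.continuous_v_slice t).intervalIntegrable _ _)
    ((S.continuous_v_slice 0).intervalIntegrable _ _)] at h
  simp only [eq_endpoints_of_periodic (S.periodic_u _), sub_self,
    intervalIntegral.integral_zero] at h
  exact (sub_eq_zero.1 h).trans S.mean_v

/-- The total energy density. -/
def energy (t x : ℝ) : ℝ := R / (γ - 1) * S.θ t x + (S.u t x) ^ 2 / 2

lemma contDiff_energy : ContDiff ℝ (⊤ : ℕ∞) fun p : ℝ × ℝ => S.energy p.1 p.2 :=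
  (contDiff_const.mul S.smooth_θ).add ((S.smooth_u.pow 2).div_const 2)

/-- The total energy is conserved. -/
lemma tInt_energy {t : ℝ} (ht : t ∈ Icc (0 : ℝ) T) : tInt (S.energy t) = tInt (S.energy 0) := by
  have hv := S.smooth_v
  have hv0 : ∀ p : ℝ × ℝ, S.v p.1 p.2 ≠ 0 := fun p => (S.v_pos _ _).ne'
  have hθ0 : ∀ p : ℝ × ℝ, S.θ p.1 p.2 ≠ 0 := fun p => (S.θ_pos _ _).ne'
  have hux := contDiff_px S.smooth_u
  have hθx := contDiff_px S.smooth_θ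
  let f₁ : ℝ → ℝ → ℝ := fun s y => μ * S.u s y * px S.u s y / S.v s y
  let f₂ : ℝ → ℝ → ℝ := fun s y =>
    kappa κ₁ κ₂ β (S.v s y) (S.θ s y) * px S.θ s y / S.v s y
  let f₃ : ℝ → ℝ → ℝ := fun s y => R * S.θ s y / S.v s y * S.u s y
  have h1 : ContDiff ℝ (⊤ : ℕ∞) fun p : ℝ × ℝ => f₁ p.1 p.2 :=
    ((contDiff_const.mul S.smooth_u).mul hux).div hv hv0
  have h2 : ContDiff ℝ (⊤ : ℕ∞) fun p : ℝ × ℝ => f₂ p.1 p.2 :=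
    ((contDiff_const.add ((contDiff_const.mul hv).mul
      (S.smooth_θ.rpow_const_of_ne hθ0))).mul hθx).div hv hv0
  have h3 : ContDiff ℝ (⊤ : ℕ∞) fun p : ℝ × ℝ => f₃ p.1 p.2 :=
    ((contDiff_const.mul S.smooth_θ).div hv hv0).mul S.smooth_u
  let g : ℝ → ℝ → ℝ := fun s y => f₁ s y + f₂ s y - f₃ s y - S.q s y
  have hg : ContDiff ℝ (⊤ : ℕ∞) fun p : ℝ × ℝ => g p.1 p.2 :=
    ((h1.add h2).sub h3).sub S.smooth_q
  have hgx : ∀ t ∈ Icc (0 : ℝ) T, ∀ x, pt S.energy t x = px g t x := by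
    intro t ht x
    have e : px g t x = px f₁ t x + px f₂ t x - px f₃ t x - px S.q t x :=
      ((((hasDerivAt_px (f := f₁) h1 t x).add (hasDerivAt_px (f := f₂) h2 t x)).sub
        (hasDerivAt_px (f := f₃) h3 t x)).sub (hasDerivAt_px S.smooth_q t x)).deriv
    have e2 := S.eq_energy t ht x
    change pt S.energy t x + px f₃ t x + px S.q t x = px f₁ t x + px f₂ t x at e2
    linarith
  have h := integral_sub_eq_of_pt_eq_px S.contDiff_energy hg hgx ht (-(1 / 2)) (1 / 2)
  rw [intervalIntegral.integral_sub
    ((contDiff_slice_right S.contDiff_energy t).continuous.intervalIntegrable _ _)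
    ((contDiff_slice_right S.contDiff_energy 0).continuous.intervalIntegrable _ _)] at h
  have hper : ∀ s, g s (1 / 2) - g s (-(1 / 2)) = 0 := by
    intro s
    simp only [g, f₁, f₂, f₃, eq_endpoints_of_periodic (S.periodic_v _),
      eq_endpoints_of_periodic (S.periodic_u _), eq_endpoints_of_periodic (S.periodic_θ _),
      eq_endpoints_of_periodic (S.periodic_q _),
      eq_endpoints_of_periodic (px_periodic S.periodic_u _),
      eq_endpoints_of_periodic (px_periodic S.periodic_θ _), sub_self]
  simp only [hper, intervalIntegral.integral_zero] at h
  exact sub_eq_zero.1 h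

lemma L2sq_bounds {M ε : ℝ} (hM : 1 ≤ M) (hS : S.Bounded M ε) :
    L2sq (S.θ 0) ≤ M ^ 2 ∧ L2sq (S.u 0) ≤ M ^ 2 ∧ L2sq (deriv (S.v 0)) ≤ M ^ 2 := by
  have h := Real.sqrt_le_left (by linarith) |>.1 hS.1
  have hn : ∀ f : ℝ → ℝ, 0 ≤ L2sq f := fun f => tInt_nonneg fun x => sq_nonneg _
  unfold H2sq at h
  have := hn (S.v 0)
  have := hn (deriv (S.v 0))
  have := hn (deriv (deriv (S.v 0)))
  have := hn (S.u 0)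
  have := hn (deriv (S.u 0))
  have := hn (deriv (deriv (S.u 0)))
  have := hn (S.θ 0)
  have := hn (deriv (S.θ 0))
  have := hn (deriv (deriv (S.θ 0)))
  refine ⟨?_, ?_, ?_⟩ <;> linarith

end Sol

lemma tInt_half_one_add_sq {h : ℝ → ℝ} (hh : Continuous h) :
    tInt (fun x => (1 + h x ^ 2) / 2) = (1 + L2sq h) / 2 := by
  have h1 := tInt_const 1
  have hc : Continuous fun x => h x ^ 2 := hh.pow 2
  unfold L2sq tInt at *
  rw [intervalIntegral.integral_div, intervalIntegral.integral_add
    (continuous_const.intervalIntegrable _ _) (hc.intervalIntegrable _ _), h1]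

lemma abs_le_half_one_add_sq (y : ℝ) : |y| ≤ (1 + y ^ 2) / 2 := by
  have := sq_nonneg (|y| - 1)
  rw [← sq_abs y]
  nlinarith

namespace Sol

variable {μ R a b κ₁ κ₂ β γ T : ℝ} (S : Sol μ R a b κ₁ κ₂ β γ T)

lemma tInt_energy_le (hR : 0 < R) (hγ : 1 < γ) {M ε : ℝ} (hM : 1 ≤ M) (hS : S.Bounded M ε) {t : ℝ}
    (ht : t ∈ Icc (0 : ℝ) T) :
    tInt (S.energy t) ≤ R / (γ - 1) * ((1 + M ^ 2) / 2) + M ^ 2 / 2 := by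
  obtain ⟨h1, h2, -⟩ := S.L2sq_bounds hM hS
  have hc : 0 < R / (γ - 1) := div_pos hR (by linarith)
  have hθ := S.continuous_θ_slice 0
  have hu := S.continuous_u_slice 0
  have h3 : tInt (S.θ 0) ≤ (1 + M ^ 2) / 2 := by
    calc tInt (S.θ 0) ≤ tInt (fun x => (1 + S.θ 0 x ^ 2) / 2) :=
          tInt_mono hθ (by fun_prop) fun x _ => (le_abs_self _).trans (abs_le_half_one_add_sq _)
      _ ≤ _ := by rw [tInt_half_one_add_sq hθ]; linarith
  have h4 : tInt (S.energy 0) = R / (γ - 1) * tInt (S.θ 0) + L2sq (S.u 0) / 2 := by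
    have hu2 : Continuous fun x => S.u 0 x ^ 2 / 2 := (hu.pow 2).div_const 2
    unfold L2sq energy tInt
    rw [intervalIntegral.integral_add ((hθ.const_mul _).intervalIntegrable _ _)
      (hu2.intervalIntegrable _ _), intervalIntegral.integral_const_mul,
      intervalIntegral.integral_div]
  rw [S.tInt_energy ht, h4]
  have := mul_le_mul_of_nonneg_left h3 hc.le
  linarith

lemma continuous_energy_slice (t : ℝ) : Continuous (S.energy t) :=
  (contDiff_slice_right S.contDiff_energy t).continuous

lemma tInt_θ_le (hR : 0 < R) (hγ : 1 < γ) {E t : ℝ} (hE : tInt (S.energy t) ≤ E) :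
    tInt (S.θ t) ≤ E / (R / (γ - 1)) := by
  have hc : 0 < R / (γ - 1) := div_pos hR (by linarith)
  rw [le_div_iff₀' hc]
  refine le_trans ?_ hE
  have : R / (γ - 1) * tInt (S.θ t) = tInt fun x => R / (γ - 1) * S.θ t x :=
    (intervalIntegral.integral_const_mul _ _).symm
  rw [this]
  refine tInt_mono ((S.continuous_θ_slice t).const_mul _) (S.continuous_energy_slice t) fun x _ => ?_
  have := sq_nonneg (S.u t x)
  unfold energy
  linarith

lemma tInt_abs_u_le (hR : 0 < R) (hγ : 1 < γ) {E t : ℝ} (hE : tInt (S.energy t) ≤ E) :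
    tInt (fun x => |S.u t x|) ≤ 1 / 2 + E := by
  have hc : 0 < R / (γ - 1) := div_pos hR (by linarith)
  have h1 : tInt (fun x => 1 / 2 + S.energy t x) = 1 / 2 + tInt (S.energy t) := by
    have h2 := tInt_const (1 / 2)
    unfold tInt at *
    rw [intervalIntegral.integral_add (continuous_const.intervalIntegrable _ _)
      ((S.continuous_energy_slice t).intervalIntegrable _ _), h2]
  calc tInt (fun x => |S.u t x|) ≤ tInt (fun x => 1 / 2 + S.energy t x) := by
        refine tInt_mono (S.continuous_u_slice t).abs
          (continuous_const.add (S.continuous_energy_slice t)) fun x _ => ?_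
        have := abs_le_half_one_add_sq (S.u t x)
        have := mul_pos hc (S.θ_pos t x)
        unfold energy
        linarith
    _ ≤ _ := by rw [h1]; linarith

lemma v_zero_le {M ε : ℝ} (hT : 0 ≤ T) (hM : 1 ≤ M) (hS : S.Bounded M ε) {x : ℝ}
    (hx : x ∈ Icc (-(1 / 2) : ℝ) (1 / 2)) : S.v 0 x ≤ 1 + (1 + M ^ 2) / 2 := by
  obtain ⟨y, hy, hle⟩ := exists_le_tInt (S.continuous_v_slice 0)
  rw [S.tInt_v ⟨le_rfl, hT⟩] at hle
  have hc : Continuous (deriv (S.v 0)) :=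
    (contDiff_slice_right (contDiff_px S.smooth_v) 0).continuous
  have h1 := abs_integral_le_tInt hc (k := fun x => (1 + deriv (S.v 0) x ^ 2) / 2)
    (by fun_prop) (fun x => abs_le_half_one_add_sq _) hy hx
  rw [tInt_half_one_add_sq hc, intervalIntegral.integral_eq_sub_of_hasDerivAt
    (fun x _ => (differentiable_slice S.smooth_v 0 x).hasDerivAt) (hc.intervalIntegrable _ _)] at h1
  have h2 := (S.L2sq_bounds hM hS).2.2
  linarith [le_abs_self (S.v 0 x - S.v 0 y)]

/-- The scaled time integral of the pressure. -/
def pressureInt (t x : ℝ) : ℝ := ∫ s in (0 : ℝ)..t, R * S.θ s x / (μ * S.v s x)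

/-- The specific volume with the contribution of the pressure factored out. -/
def volFactor (t x : ℝ) : ℝ := S.v t x * exp (-S.pressureInt t x)

lemma volFactor_pos (t x : ℝ) : 0 < S.volFactor t x := mul_pos (S.v_pos t x) (exp_pos _)

lemma continuous_pressure (hμ : 0 < μ) :
    Continuous fun p : ℝ × ℝ => R * S.θ p.1 p.2 / (μ * S.v p.1 p.2) :=
  (continuous_const.mul S.continuous_θ).div (continuous_const.mul S.continuous_v)
    fun _ => (mul_pos hμ (S.v_pos _ _)).ne'

lemma continuous_pressureInt (hμ : 0 < μ) :
    Continuous fun p : ℝ × ℝ => S.pressureInt p.1 p.2 := by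
  unfold pressureInt
  apply intervalIntegral.continuous_parametric_intervalIntegral_of_continuous
    (f := fun (p : ℝ × ℝ) s => R * S.θ s p.2 / (μ * S.v s p.2)) _ continuous_fst
  exact (S.continuous_pressure hμ).comp
    (continuous_snd.prodMk (continuous_snd.comp continuous_fst))

lemma continuous_volFactor (hμ : 0 < μ) :
    Continuous fun p : ℝ × ℝ => S.volFactor p.1 p.2 :=
  S.continuous_v.mul (S.continuous_pressureInt hμ).neg.rexp

lemma hasDerivAt_pressureInt (hμ : 0 < μ) (t x : ℝ) :
    HasDerivAt (fun s => S.pressureInt s x) (R * S.θ t x / (μ * S.v t x)) t := by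
  have hc : Continuous fun s => R * S.θ s x / (μ * S.v s x) :=
    (S.continuous_pressure hμ).comp (Continuous.prodMk continuous_id continuous_const)
  exact intervalIntegral.integral_hasDerivAt_right (hc.intervalIntegrable _ _)
      hc.stronglyMeasurable.stronglyMeasurableAtFilter hc.continuousAt

/-- The effective viscous stress. -/
def stress (t x : ℝ) : ℝ := μ * px S.u t x / S.v t x - R * S.θ t x / S.v t x

lemma contDiff_stress : ContDiff ℝ (⊤ : ℕ∞) fun p : ℝ × ℝ => S.stress p.1 p.2 :=
  ((contDiff_const.mul (contDiff_px S.smooth_u)).div S.smooth_v fun _ => (S.v_pos _ _).ne').sub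
    ((contDiff_const.mul S.smooth_θ).div S.smooth_v fun _ => (S.v_pos _ _).ne')

lemma pt_u_eq {t : ℝ} (ht : t ∈ Icc (0 : ℝ) T) (x : ℝ) : pt S.u t x = px S.stress t x := by
  let f₁ : ℝ → ℝ → ℝ := fun s y => μ * px S.u s y / S.v s y
  let f₂ : ℝ → ℝ → ℝ := fun s y => R * S.θ s y / S.v s y
  have h1 : ContDiff ℝ (⊤ : ℕ∞) fun p : ℝ × ℝ => f₁ p.1 p.2 :=
    (contDiff_const.mul (contDiff_px S.smooth_u)).div S.smooth_v fun _ => (S.v_pos _ _).ne'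
  have h2 : ContDiff ℝ (⊤ : ℕ∞) fun p : ℝ × ℝ => f₂ p.1 p.2 :=
    (contDiff_const.mul S.smooth_θ).div S.smooth_v fun _ => (S.v_pos _ _).ne'
  have e : px S.stress t x = px f₁ t x - px f₂ t x :=
    ((hasDerivAt_px (f := f₁) h1 t x).sub (hasDerivAt_px (f := f₂) h2 t x)).deriv
  have e2 := S.eq_mom t ht x
  change pt S.u t x + px f₂ t x = px f₁ t x at e2
  linarith

lemma log_v_sub_pressureInt (hμ : 0 < μ) {t : ℝ} (ht : t ∈ Icc (0 : ℝ) T) (x : ℝ) :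
    log (S.v t x) - S.pressureInt t x
      = log (S.v 0 x) + (∫ s in (0 : ℝ)..t, S.stress s x) / μ := by
  have hσ : Continuous fun s => S.stress s x := (contDiff_slice_left S.contDiff_stress x).continuous
  have hp : Continuous fun s => R * S.θ s x / (μ * S.v s x) :=
    (S.continuous_pressure hμ).comp (Continuous.prodMk continuous_id continuous_const)
  have h : ∫ s in (0 : ℝ)..t, (S.stress s x / μ + R * S.θ s x / (μ * S.v s x))
      = log (S.v t x) - log (S.v 0 x) := by
    apply intervalIntegral.integral_eq_sub_of_hasDerivAt (f := fun s => log (S.v s x))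
    · intro s hs
      rw [uIcc_of_le ht.1] at hs
      have h1 := (hasDerivAt_pt S.smooth_v s x).log (S.v_pos s x).ne'
      rw [sub_eq_zero.1 (S.eq_mass s ⟨hs.1, hs.2.trans ht.2⟩ x)] at h1
      have := (S.v_pos s x).ne'
      have e : S.stress s x / μ + R * S.θ s x / (μ * S.v s x) = px S.u s x / S.v s x := by
        unfold stress
        field_simp
        ring
      rw [e]
      exact h1
    · exact ((hσ.div_const _).add hp).intervalIntegrable _ _
  rw [intervalIntegral.integral_add ((hσ.div_const _).intervalIntegrable _ _)
    (hp.intervalIntegrable _ _), intervalIntegral.integral_div] at h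
  unfold pressureInt
  linarith

/-- A Harnack inequality for the volume factor. -/
lemma volFactor_le (hμ : 0 < μ) {N L ε : ℝ} (hε : 0 < ε)
    (hN : ∀ x ∈ Icc (-(1 / 2) : ℝ) (1 / 2), S.v 0 x ≤ N) (hv : ∀ x, ε ≤ S.v 0 x)
    (hL : ∀ t ∈ Icc (0 : ℝ) T, tInt (fun x => |S.u t x|) ≤ L) {t x y : ℝ}
    (ht : t ∈ Icc (0 : ℝ) T) (hx : x ∈ Icc (-(1 / 2) : ℝ) (1 / 2))
    (hy : y ∈ Icc (-(1 / 2) : ℝ) (1 / 2)) :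
    S.volFactor t x ≤ N / ε * exp (2 * L / μ) * S.volFactor t y := by
  have hσ : ∀ z, Continuous fun s => S.stress s z :=
    fun z => (contDiff_slice_left S.contDiff_stress z).continuous
  have h1 := integral_sub_eq_of_pt_eq_px S.smooth_u S.contDiff_stress
    (fun t ht x => S.pt_u_eq ht x) ht y x
  rw [intervalIntegral.integral_sub ((hσ x).intervalIntegrable _ _)
    ((hσ y).intervalIntegrable _ _)] at h1
  have hut := S.continuous_u_slice t
  have hu0 := S.continuous_u_slice 0
  have h2 := abs_integral_le_tInt (h := fun z => S.u t z - S.u 0 z)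
    (k := fun z => |S.u t z| + |S.u 0 z|) (by fun_prop) (by fun_prop)
    (fun z => abs_sub _ _) hy hx
  have h3 : tInt (fun z => |S.u t z| + |S.u 0 z|)
      = tInt (fun z => |S.u t z|) + tInt (fun z => |S.u 0 z|) :=
    intervalIntegral.integral_add (hut.abs.intervalIntegrable _ _)
      (hu0.abs.intervalIntegrable _ _)
  have h4 := hL t ht
  have h5 := hL 0 ⟨le_rfl, ht.1.trans ht.2⟩
  have h6 : (∫ s in (0 : ℝ)..t, S.stress s x) - ∫ s in (0 : ℝ)..t, S.stress s y ≤ 2 * L := by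
    rw [← h1]
    linarith [(le_abs_self _).trans h2]
  have hvx := S.log_v_sub_pressureInt hμ ht x
  have hvy := S.log_v_sub_pressureInt hμ ht y
  have hN0 : 0 < N := (S.v_pos 0 x).trans_le (hN x hx)
  have h7 : log (S.v 0 x) ≤ log N := log_le_log (S.v_pos 0 x) (hN x hx)
  have h8 : log ε ≤ log (S.v 0 y) := log_le_log hε (hv y)
  have hexp : ∀ z, S.volFactor t z = exp (log (S.v t z) - S.pressureInt t z) := fun z => by
    rw [sub_eq_add_neg, exp_add, exp_log (S.v_pos t z)]; rfl
  have hNε : N / ε = exp (log N - log ε) := by rw [exp_sub, exp_log hN0, exp_log hε]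
  rw [hexp, hexp, hNε, ← exp_add, ← exp_add, hvx, hvy]
  apply exp_le_exp.2
  have h9 := div_le_div_of_nonneg_right h6 hμ.le
  rw [sub_div] at h9
  linarith

lemma exp_pressureInt_le (hμ : 0 < μ) (hR : 0 < R) {K : ℝ}
    (hK : ∀ t ∈ Icc (0 : ℝ) T, ∀ x ∈ Icc (-(1 / 2) : ℝ) (1 / 2),
      S.volFactor t 0 ≤ K * S.volFactor t x) {t x : ℝ}
    (ht : t ∈ Icc (0 : ℝ) T) (hx : x ∈ Icc (-(1 / 2) : ℝ) (1 / 2)) :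
    exp (S.pressureInt t x)
      ≤ 1 + R * K / μ * ∫ s in (0 : ℝ)..t, S.θ s x * (S.volFactor s 0)⁻¹ := by
  have hi : ∀ z : ℝ, Continuous fun s : ℝ => (s, z) := fun z => continuous_id.prodMk continuous_const
  have hθ : Continuous fun s => S.θ s x := S.continuous_θ.comp (hi x)
  have hF : Continuous fun s => (S.volFactor s 0)⁻¹ :=
    ((S.continuous_volFactor hμ).comp (hi 0)).inv₀ fun s => (S.volFactor_pos s 0).ne'
  have hc : Continuous fun s =>
      exp (S.pressureInt s x) * (R * S.θ s x / (μ * S.v s x)) :=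
    ((S.continuous_pressureInt hμ).comp (hi x)).rexp.mul ((S.continuous_pressure hμ).comp (hi x))
  have h := intervalIntegral.integral_eq_sub_of_hasDerivAt (a := 0) (b := t)
    (fun s _ => (S.hasDerivAt_pressureInt hμ s x).exp) (hc.intervalIntegrable _ _)
  have h0 : S.pressureInt 0 x = 0 := intervalIntegral.integral_same
  rw [h0, exp_zero] at h
  have h1 : ∫ s in (0 : ℝ)..t, exp (S.pressureInt s x) * (R * S.θ s x / (μ * S.v s x))
      ≤ ∫ s in (0 : ℝ)..t, R * K / μ * (S.θ s x * (S.volFactor s 0)⁻¹) := by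
    refine intervalIntegral.integral_mono_on ht.1 (hc.intervalIntegrable _ _)
      ((hθ.mul hF).const_mul _ |>.intervalIntegrable _ _) fun s hs => ?_
    have hk := hK s ⟨hs.1, hs.2.trans ht.2⟩ x hx
    have hinv : (S.volFactor s x)⁻¹ ≤ K * (S.volFactor s 0)⁻¹ := by
      rw [← div_eq_mul_inv, le_div_iff₀ (S.volFactor_pos s 0), inv_mul_le_iff₀ (S.volFactor_pos s x)]
      linarith
    have e : exp (S.pressureInt s x) * (R * S.θ s x / (μ * S.v s x))
        = R / μ * S.θ s x * (S.volFactor s x)⁻¹ := by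
      unfold volFactor
      rw [exp_neg]
      have := (S.v_pos s x).ne'
      field_simp
    rw [e]
    have := mul_le_mul_of_nonneg_left hinv
      (mul_nonneg (div_nonneg hR.le hμ.le) (S.θ_pos s x).le)
    calc _ ≤ _ := this
      _ = _ := by ring
  rw [intervalIntegral.integral_const_mul] at h1
  linarith

/-- The reciprocal of the volume factor is bounded, by Grönwall's inequality. -/
lemma inv_volFactor_le (hμ : 0 < μ) (hR : 0 < R) {K Θ : ℝ} (hK0 : 0 < K)
    (hK : ∀ t ∈ Icc (0 : ℝ) T, ∀ x ∈ Icc (-(1 / 2) : ℝ) (1 / 2),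
      ∀ y ∈ Icc (-(1 / 2) : ℝ) (1 / 2), S.volFactor t x ≤ K * S.volFactor t y)
    (hΘ : ∀ t ∈ Icc (0 : ℝ) T, tInt (S.θ t) ≤ Θ) {t : ℝ}
    (ht : t ∈ Icc (0 : ℝ) T) :
    (S.volFactor t 0)⁻¹
      ≤ K + K * (R * K / μ) * Θ * gronwallBound 0 (K * (R * K / μ) * Θ) K T := by
  have hz : (0 : ℝ) ∈ Icc (-(1 / 2) : ℝ) (1 / 2) := by constructor <;> norm_num
  have hΘ0 : 0 ≤ Θ := (tInt_nonneg fun x => (S.θ_pos t x).le).trans (hΘ t ht)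
  have hF : Continuous fun s => (S.volFactor s 0)⁻¹ :=
    ((S.continuous_volFactor hμ).comp (continuous_id.prodMk continuous_const)).inv₀
      fun s => (S.volFactor_pos s 0).ne'
  have hF0 : ∀ s, 0 ≤ (S.volFactor s 0)⁻¹ := fun s => (inv_pos.2 (S.volFactor_pos s 0)).le
  refine le_of_le_add_integral hF hF0 hK0.le (by positivity) (fun t ht => ?_) ht
  have hθF : Continuous fun p : ℝ × ℝ => S.θ p.1 p.2 * (S.volFactor p.1 0)⁻¹ :=
    S.continuous_θ.mul (hF.comp continuous_fst)
  have hJ : Continuous fun x => ∫ s in (0 : ℝ)..t, S.θ s x * (S.volFactor s 0)⁻¹ :=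
    intervalIntegral.continuous_parametric_intervalIntegral_of_continuous'
      (f := fun x s => S.θ s x * (S.volFactor s 0)⁻¹) (hθF.comp continuous_swap) _ _
  have h1 : (1 : ℝ) ≤ tInt fun x => K * S.volFactor t 0 *
      (1 + R * K / μ * ∫ s in (0 : ℝ)..t, S.θ s x * (S.volFactor s 0)⁻¹) := by
    refine (S.tInt_v ht).ge.trans (tInt_mono (S.continuous_v_slice t) (by fun_prop) fun x hx => ?_)
    have e : S.v t x = S.volFactor t x * exp (S.pressureInt t x) := by
      unfold volFactor
      rw [mul_assoc, ← exp_add, neg_add_cancel, exp_zero, mul_one]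
    rw [e]
    exact mul_le_mul (hK t ht x hx 0 hz)
      (S.exp_pressureInt_le hμ hR (fun s hs z hz' => hK s hs 0 hz z hz') ht hx)
      (exp_pos _).le (mul_pos hK0 (S.volFactor_pos t 0)).le
  have h2 : (tInt fun x => K * S.volFactor t 0 *
      (1 + R * K / μ * ∫ s in (0 : ℝ)..t, S.θ s x * (S.volFactor s 0)⁻¹))
      = K * S.volFactor t 0 * (1 + R * K / μ *
        ∫ s in (0 : ℝ)..t, tInt (S.θ s) * (S.volFactor s 0)⁻¹) := by
    have h3 := tInt_const 1
    unfold tInt at *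
    rw [intervalIntegral.integral_const_mul, intervalIntegral.integral_add
      (continuous_const.intervalIntegrable _ _) ((hJ.const_mul _).intervalIntegrable _ _), h3,
      intervalIntegral.integral_const_mul, ← integral_swap_of_continuous hθF]
    simp_rw [intervalIntegral.integral_mul_const]
  have h4 : ∫ s in (0 : ℝ)..t, tInt (S.θ s) * (S.volFactor s 0)⁻¹
      ≤ Θ * ∫ s in (0 : ℝ)..t, (S.volFactor s 0)⁻¹ := by
    rw [← intervalIntegral.integral_const_mul]
    refine intervalIntegral.integral_mono_on ht.1
      (((continuous_tInt S.continuous_θ).mul hF).intervalIntegrable _ _)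
      ((hF.const_mul _).intervalIntegrable _ _) fun s hs => ?_
    exact mul_le_mul_of_nonneg_right (hΘ s ⟨hs.1, hs.2.trans ht.2⟩) (hF0 s)
  rw [h2] at h1
  rw [inv_le_iff_one_le_mul₀ (S.volFactor_pos t 0)]
  refine h1.trans ?_
  have hA := S.volFactor_pos t 0
  have h5 := mul_le_mul_of_nonneg_left h4 (by positivity : 0 ≤ R * K / μ)
  calc _ ≤ K * S.volFactor t 0 * (1 + R * K / μ *
        (Θ * ∫ s in (0 : ℝ)..t, (S.volFactor s 0)⁻¹)) := by gcongr
    _ = _ := by ring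

lemma v_le (hμ : 0 < μ) (hR : 0 < R) {K B m : ℝ} (hK0 : 0 < K)
    (hK : ∀ t ∈ Icc (0 : ℝ) T, ∀ x ∈ Icc (-(1 / 2) : ℝ) (1 / 2),
      ∀ y ∈ Icc (-(1 / 2) : ℝ) (1 / 2), S.volFactor t x ≤ K * S.volFactor t y)
    (hB : ∀ t ∈ Icc (0 : ℝ) T, (S.volFactor t 0)⁻¹ ≤ B) {t x : ℝ}
    (ht : t ∈ Icc (0 : ℝ) T) (hx : x ∈ Icc (-(1 / 2) : ℝ) (1 / 2))
    (hm : ∀ s ∈ Icc (0 : ℝ) t, S.θ s x ≤ m) :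
    S.v t x ≤ K ^ 2 * (1 + R * K / μ * (T * (m * B))) := by
  have hz : (0 : ℝ) ∈ Icc (-(1 / 2) : ℝ) (1 / 2) := by constructor <;> norm_num
  have hm0 : 0 ≤ m := (S.θ_pos 0 x).le.trans (hm 0 ⟨le_rfl, ht.1⟩)
  have hB0 : 0 ≤ B := (inv_pos.2 (S.volFactor_pos t 0)).le.trans (hB t ht)
  have hF : Continuous fun s => (S.volFactor s 0)⁻¹ :=
    ((S.continuous_volFactor hμ).comp (continuous_id.prodMk continuous_const)).inv₀
      fun s => (S.volFactor_pos s 0).ne'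
  have hθ : Continuous fun s => S.θ s x :=
    S.continuous_θ.comp (continuous_id.prodMk continuous_const)
  have h1 : ∫ s in (0 : ℝ)..t, S.θ s x * (S.volFactor s 0)⁻¹ ≤ T * (m * B) := by
    calc _ ≤ ∫ _ in (0 : ℝ)..t, m * B := by
          refine intervalIntegral.integral_mono_on ht.1 ((hθ.mul hF).intervalIntegrable _ _)
            (continuous_const.intervalIntegrable _ _) fun s hs => ?_
          exact mul_le_mul (hm s hs) (hB s ⟨hs.1, hs.2.trans ht.2⟩)
            (inv_pos.2 (S.volFactor_pos s 0)).le hm0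
      _ = t * (m * B) := by simp [mul_left_comm]
      _ ≤ _ := mul_le_mul_of_nonneg_right ht.2 (by positivity)
  have hA : S.volFactor t 0 ≤ K := by
    have h2 : S.volFactor t 0 = tInt fun _ => S.volFactor t 0 := (tInt_const _).symm
    have h3 : (tInt fun y => K * S.v t y) = K * tInt (S.v t) :=
      intervalIntegral.integral_const_mul _ _
    rw [S.tInt_v ht, mul_one] at h3
    rw [h2, ← h3]
    refine tInt_mono continuous_const ((S.continuous_v_slice t).const_mul K) fun y hy => ?_
    refine (hK t ht 0 hz y hy).trans (mul_le_mul_of_nonneg_left ?_ hK0.le)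
    have hP : 0 ≤ S.pressureInt t y := intervalIntegral.integral_nonneg_of_forall ht.1 fun s =>
      div_nonneg (mul_nonneg hR.le (S.θ_pos s y).le) (mul_nonneg hμ.le (S.v_pos s y).le)
    exact mul_le_of_le_one_right (S.v_pos t y).le (exp_le_one_iff.2 (neg_nonpos.2 hP))
  have e : S.v t x = S.volFactor t x * exp (S.pressureInt t x) := by
    unfold volFactor
    rw [mul_assoc, ← exp_add, neg_add_cancel, exp_zero, mul_one]
  have h4 := S.exp_pressureInt_le hμ hR (fun s hs z hz' => hK s hs 0 hz z hz') ht hx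
  have h5 : S.volFactor t x ≤ K ^ 2 := by
    rw [sq]
    exact (hK t ht x hx 0 hz).trans (mul_le_mul_of_nonneg_left hA hK0.le)
  rw [e]
  refine mul_le_mul h5 (h4.trans ?_) (exp_pos _).le (sq_nonneg K)
  gcongr

end Sol

namespace Sol

variable {μ R a b κ₁ κ₂ β γ T : ℝ} (S : Sol μ R a b κ₁ κ₂ β γ T)

/-- The density of the functional `Sol.Y`. -/
def heatFluxSq (s x : ℝ) : ℝ :=
  (kappa κ₁ κ₂ β (S.v s x) (S.θ s x)) ^ 2 * (px S.θ s x) ^ 2 / (S.v s x) ^ 2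

lemma heatFluxSq_nonneg (s x : ℝ) : 0 ≤ S.heatFluxSq s x := by
  unfold heatFluxSq; positivity

lemma continuous_heatFluxSq : Continuous fun p : ℝ × ℝ => S.heatFluxSq p.1 p.2 := by
  have hθ : Continuous fun p : ℝ × ℝ => S.θ p.1 p.2 ^ β :=
    S.continuous_θ.rpow_const fun p => Or.inl (S.θ_pos _ _).ne'
  exact ((((continuous_const.add ((continuous_const.mul S.continuous_v).mul hθ))).pow 2).mul
    ((contDiff_px S.smooth_θ).continuous.pow 2)).div (S.continuous_v.pow 2)
    fun p => pow_ne_zero 2 (S.v_pos _ _).ne'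

lemma tInt_heatFluxSq_le_Y {s t : ℝ} (hs : s ∈ Icc (0 : ℝ) t) :
    tInt (S.heatFluxSq s) ≤ S.Y t :=
  le_csSup (isCompact_Icc.bddAbove_image
    (continuous_tInt S.continuous_heatFluxSq).continuousOn) ⟨s, hs, rfl⟩

lemma sq_le_heatFluxSq (hκ₁ : 0 < κ₁) (hκ₂ : 0 < κ₂) (s x : ℝ) :
    (S.θ s x ^ β * px S.θ s x) ^ 2 ≤ S.heatFluxSq s x / κ₂ ^ 2 := by
  have hv := S.v_pos s x
  have hθ := rpow_pos_of_pos (S.θ_pos s x) β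
  unfold heatFluxSq kappa
  rw [le_div_iff₀ (by positivity), le_div_iff₀ (by positivity)]
  calc (S.θ s x ^ β * px S.θ s x) ^ 2 * κ₂ ^ 2 * S.v s x ^ 2
      = (κ₂ * S.v s x * S.θ s x ^ β) ^ 2 * px S.θ s x ^ 2 := by ring
    _ ≤ (κ₁ + κ₂ * S.v s x * S.θ s x ^ β) ^ 2 * px S.θ s x ^ 2 := by
        gcongr
        linarith

/-- The temperature is controlled pointwise by its mean and by the weighted heat flux. -/
lemma rpow_θ_le (hκ₁ : 0 < κ₁) (hκ₂ : 0 < κ₂) (hβ : 0 < β) {Θ Y s x : ℝ}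
    (hΘ : tInt (S.θ s) ≤ Θ) (hY0 : 0 ≤ Y) (hY : tInt (S.heatFluxSq s) ≤ Y)
    (hx : x ∈ Icc (-(1 / 2) : ℝ) (1 / 2)) :
    S.θ s x ^ (β + 3 / 2)
      ≤ (Θ ^ (β + 3 / 2) + (β + 3 / 2) / 2 * (Θ + 1 / κ₂ ^ 2)) * √(1 + Y) := by
  have hθc := S.continuous_θ_slice s
  have hDc : Continuous (S.heatFluxSq s) :=
    S.continuous_heatFluxSq.comp (Continuous.prodMk continuous_const continuous_id)
  obtain ⟨y, hy, hyle⟩ := exists_le_tInt hθc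
  have hΘ0 : 0 ≤ Θ := (S.θ_pos s y).le.trans (hyle.trans hΘ)
  set l := √(1 + Y) with hl
  have hl1 : 1 ≤ l := by rw [hl]; exact Real.one_le_sqrt.2 (by linarith)
  have hl2 : l ^ 2 = 1 + Y := Real.sq_sqrt (by linarith)
  have hl0 : 0 < l := by linarith
  set p := β + 3 / 2 with hp
  have hp0 : 0 < p := by rw [hp]; linarith
  have hder : ∀ z, HasDerivAt (fun z => S.θ s z ^ p)
      (px S.θ s z * p * S.θ s z ^ (p - 1)) z := fun z =>
    (hasDerivAt_px S.smooth_θ s z).rpow_const (Or.inl (S.θ_pos s z).ne')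
  have hdc : Continuous fun z => px S.θ s z * p * S.θ s z ^ (p - 1) :=
    ((contDiff_slice_right (contDiff_px S.smooth_θ) s).continuous.mul continuous_const).mul
      (hθc.rpow_const fun z => Or.inl (S.θ_pos s z).ne')
  have hbound : ∀ z, |px S.θ s z * p * S.θ s z ^ (p - 1)|
      ≤ p / 2 * l * S.θ s z + p / 2 / (κ₂ ^ 2 * l) * S.heatFluxSq s z := by
    intro z
    have hθ := S.θ_pos s z
    have e1 : S.θ s z ^ (p - 1) = S.θ s z ^ β * √(S.θ s z) := by
      rw [Real.sqrt_eq_rpow, ← rpow_add hθ]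
      congr 1
      rw [hp]; ring
    have h1 := S.sq_le_heatFluxSq hκ₁ hκ₂ s z
    have h2 := Real.sq_sqrt hθ.le
    have h3 := Real.sqrt_nonneg (S.θ s z)
    have hb0 := rpow_pos_of_pos hθ β
    rw [e1]
    set c := √(S.θ s z)
    set d := S.θ s z ^ β * px S.θ s z with hd
    have e2 : |px S.θ s z * p * (S.θ s z ^ β * c)| = p * (|d| * c) := by
      rw [hd, abs_mul, abs_mul, abs_mul, abs_mul, abs_of_pos hp0, abs_of_nonneg h3]
      ring
    rw [e2]
    have h4 : |d| * c ≤ (l * c ^ 2 + d ^ 2 / l) / 2 := by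
      have h5 : 0 ≤ (l * c - |d|) ^ 2 / l := by positivity
      have h6 : (l * c - |d|) ^ 2 / l = l * c ^ 2 - 2 * (|d| * c) + d ^ 2 / l := by
        rw [← sq_abs d]
        field_simp
        ring
      linarith
    have h7 : d ^ 2 / l ≤ S.heatFluxSq s z / κ₂ ^ 2 / l := div_le_div_of_nonneg_right h1 hl0.le
    calc p * (|d| * c) ≤ p * ((l * c ^ 2 + S.heatFluxSq s z / κ₂ ^ 2 / l) / 2) := by
          apply mul_le_mul_of_nonneg_left _ hp0.le
          linarith
      _ = _ := by
          rw [h2]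
          field_simp
  have h1 := abs_integral_le_tInt hdc (by fun_prop) hbound hy hx
  rw [intervalIntegral.integral_eq_sub_of_hasDerivAt (fun z _ => hder z)
    (hdc.intervalIntegrable _ _)] at h1
  have h2 : tInt (fun z => p / 2 * l * S.θ s z + p / 2 / (κ₂ ^ 2 * l) * S.heatFluxSq s z)
      = p / 2 * l * tInt (S.θ s) + p / 2 / (κ₂ ^ 2 * l) * tInt (S.heatFluxSq s) := by
    unfold tInt
    rw [intervalIntegral.integral_add ((hθc.const_mul _).intervalIntegrable _ _)
      ((hDc.const_mul _).intervalIntegrable _ _), intervalIntegral.integral_const_mul,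
      intervalIntegral.integral_const_mul]
  rw [h2] at h1
  have h3 : p / 2 * l * tInt (S.θ s) ≤ p / 2 * l * Θ := by gcongr
  have h4 : p / 2 / (κ₂ ^ 2 * l) * tInt (S.heatFluxSq s) ≤ p / 2 / (κ₂ ^ 2 * l) * l ^ 2 := by
    gcongr
    linarith
  have h5 : p / 2 / (κ₂ ^ 2 * l) * l ^ 2 = p / 2 * (1 / κ₂ ^ 2) * l := by field_simp
  have h6 : S.θ s y ^ p ≤ Θ ^ p :=
    rpow_le_rpow (S.θ_pos s y).le (hyle.trans hΘ) hp0.le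
  have h7 : Θ ^ p ≤ Θ ^ p * l := le_mul_of_one_le_right (rpow_nonneg hΘ0 _) hl1
  have h8 := (le_abs_self _).trans h1
  nlinarith

lemma θ_le (hκ₁ : 0 < κ₁) (hκ₂ : 0 < κ₂) (hβ : 0 < β) {Θ Y s x : ℝ}
    (hΘ : tInt (S.θ s) ≤ Θ) (hY0 : 0 ≤ Y) (hY : tInt (S.heatFluxSq s) ≤ Y)
    (hx : x ∈ Icc (-(1 / 2) : ℝ) (1 / 2)) :
    S.θ s x ≤ (Θ ^ (β + 3 / 2) + (β + 3 / 2) / 2 * (Θ + 1 / κ₂ ^ 2)) ^ (β + 3 / 2)⁻¹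
      * (1 + Y ^ (1 / (2 * β + 3))) := by
  have hΘ0 : 0 ≤ Θ := (tInt_nonneg fun x => (S.θ_pos s x).le).trans hΘ
  have hp0 : 0 < β + 3 / 2 := by linarith
  have hθ := (S.θ_pos s x).le
  have h1 := S.rpow_θ_le hκ₁ hκ₂ hβ hΘ hY0 hY hx
  have h2 := rpow_le_rpow (rpow_nonneg hθ _) h1 (inv_pos.2 hp0).le
  have hA : 0 ≤ Θ ^ (β + 3 / 2) + (β + 3 / 2) / 2 * (Θ + 1 / κ₂ ^ 2) := by
    have := rpow_nonneg hΘ0 (β + 3 / 2)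
    positivity
  rw [rpow_rpow_inv hθ hp0.ne', mul_rpow hA (Real.sqrt_nonneg _)] at h2
  refine h2.trans (mul_le_mul_of_nonneg_left ?_ (rpow_nonneg hA _))
  have he : √(1 + Y) ^ (β + 3 / 2)⁻¹ = (1 + Y) ^ (1 / (2 * β + 3)) := by
    rw [Real.sqrt_eq_rpow, ← rpow_mul (by linarith)]
    congr 1
    field_simp
  rw [he]
  have h3 := rpow_add_le_add_rpow (zero_le_one' ℝ) hY0
    (by positivity : 0 ≤ 1 / (2 * β + 3)) ((div_le_one (by linarith)).2 (by linarith))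
  rwa [one_rpow] at h3

end Sol

end RadHydro

theorem stmt_5 (μ R a b κ₁ κ₂ β γ : ℝ)
    (hμ : 0 < μ) (hR : 0 < R) (ha : 0 < a) (hb : 0 < b)
    (hκ₁ : 0 < κ₁) (hκ₂ : 0 < κ₂) (hβ : 0 < β) (hγ : 1 < γ)
    (T M ε : ℝ) (hT : 0 < T) (hM : 1 ≤ M) (hε0 : 0 < ε) (hε1 : ε ≤ 1) :
    ∃ C : ℝ, 0 < C ∧
      ∀ S : Sol μ R a b κ₁ κ₂ β γ T, S.Bounded M ε →
        ∀ t ∈ Icc (0 : ℝ) T,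
          Linf (S.v t) ≤ C * (1 + S.Y t ^ (1 / (2 * β + 3))) := by
  set E := R / (γ - 1) * ((1 + M ^ 2) / 2) + M ^ 2 / 2
  set Θ := E / (R / (γ - 1))
  set K := (1 + (1 + M ^ 2) / 2) / ε * exp (2 * (1 / 2 + E) / μ)
  set B := K + K * (R * K / μ) * Θ * gronwallBound 0 (K * (R * K / μ) * Θ) K T
  set A := (Θ ^ (β + 3 / 2) + (β + 3 / 2) / 2 * (Θ + 1 / κ₂ ^ 2)) ^ (β + 3 / 2)⁻¹
  have hc : 0 < R / (γ - 1) := div_pos hR (by linarith)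
  have hE : 0 < E := by positivity
  have hΘ : 0 < Θ := div_pos hE hc
  have hK : 0 < K := by positivity
  have hB : 0 < B := by
    have h := gronwallBound_mono (le_refl (0 : ℝ)) hK.le
      (by positivity : 0 ≤ K * (R * K / μ) * Θ) hT.le
    rw [gronwallBound_x0] at h
    positivity
  have hA : 0 < A := by
    have := rpow_pos_of_pos hΘ (β + 3 / 2)
    positivity
  refine ⟨K ^ 2 * (1 + R * K / μ * (T * (A * B))), by positivity, fun S hS t ht => ?_⟩
  have hen := fun s (hs : s ∈ Icc (0 : ℝ) T) => S.tInt_energy_le hR hγ hM hS hs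
  have hθ := fun s (hs : s ∈ Icc (0 : ℝ) T) => S.tInt_θ_le hR hγ (hen s hs)
  have hharnack : ∀ t ∈ Icc (0 : ℝ) T, ∀ x ∈ Icc (-(1 / 2) : ℝ) (1 / 2),
      ∀ y ∈ Icc (-(1 / 2) : ℝ) (1 / 2), S.volFactor t x ≤ K * S.volFactor t y :=
    fun s hs x hx y hy => S.volFactor_le hμ hε0 (fun z hz => S.v_zero_le hT.le hM hS hz)
      hS.2.1 (fun r hr => S.tInt_abs_u_le hR hγ (hen r hr)) hs hx hy
  have hY0 : 0 ≤ S.Y t := (tInt_nonneg (S.heatFluxSq_nonneg 0)).trans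
    (S.tInt_heatFluxSq_le_Y ⟨le_rfl, ht.1⟩)
  have hZ := rpow_nonneg hY0 (1 / (2 * β + 3))
  refine csSup_le ((nonempty_Icc.2 (by norm_num)).image _) ?_
  rintro _ ⟨x, hx, rfl⟩
  have hv := S.v_le hμ hR hK hharnack
    (fun s hs => S.inv_volFactor_le hμ hR hK hharnack hθ hs) ht hx
    fun s hs => S.θ_le hκ₁ hκ₂ hβ (hθ s ⟨hs.1, hs.2.trans ht.2⟩) hY0
      (S.tInt_heatFluxSq_le_Y hs) hx
  simp only [abs_of_pos (S.v_pos t x)]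
  refine hv.trans ?_
  calc K ^ 2 * (1 + R * K / μ * (T * (A * (1 + S.Y t ^ (1 / (2 * β + 3))) * B)))
      ≤ K ^ 2 * ((1 + S.Y t ^ (1 / (2 * β + 3)))
        + R * K / μ * (T * (A * (1 + S.Y t ^ (1 / (2 * β + 3))) * B))) := by
        gcongr
        linarith
    _ = _ := by ring
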